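/- arXiv:1504.00079 — 2 statements merged into one kernel-verified Lean document; each statement's English description precedes it below -/
import Mathlib

section
/- Define the entire function F(z) = Σ_{k=0}^∞ (−1)^k (Γ((k+1)/2)/k!) z^k. There is a constant C such that for every t > 0, |F(t e^{iπ/4})| ≤ C · min(1, 1/t). -/
open MeasureTheory Set Filter

/-- The entire function `F(z) = Σ_{k=0}^∞ (−1)^k (Γ((k+1)/2)/k!) z^k`. -/
noncomputable def kummerF (z : ℂ) : ℂ :=
  ∑' k : ℕ, ((-1 : ℂ) ^ k * ((Real.Gamma (((k : ℝ) + 1) / 2) / (Nat.factorial k) : ℝ) : ℂ)) * z ^ k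

/-- The terms of the expansion of `2 exp (-s² - z s)` in powers of `z`. -/
noncomputable def gaussianLaplaceTerm (z : ℂ) (k : ℕ) (s : ℝ) : ℂ :=
  2 * ((-z) ^ k / (k.factorial : ℂ)) * ((s ^ k * Real.exp (-s ^ 2) : ℝ) : ℂ)

lemma integral_gaussianLaplaceTerm (z : ℂ) (k : ℕ) :
    ∫ s in Ioi (0 : ℝ), gaussianLaplaceTerm z k s =
      ((-1 : ℂ) ^ k * ((Real.Gamma (((k : ℝ) + 1) / 2) / (Nat.factorial k) : ℝ) : ℂ)) * z ^ k := by
  have h : ∫ s in Ioi (0 : ℝ), s ^ k * Real.exp (-s ^ 2) =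
      1 / 2 * Real.Gamma (((k : ℝ) + 1) / 2) := by
    rw [← integral_rpow_mul_exp_neg_rpow (p := 2) (q := k) two_pos
      (lt_of_lt_of_le (by norm_num) k.cast_nonneg)]
    simp only [Real.rpow_natCast, Real.rpow_two]
  unfold gaussianLaplaceTerm
  rw [integral_const_mul, integral_complex_ofReal, h, neg_pow]
  push_cast
  ring

lemma hasSum_gaussianLaplaceTerm (z : ℂ) (s : ℝ) :
    HasSum (fun k => gaussianLaplaceTerm z k s) (2 * Complex.exp (-s ^ 2 - z * s)) := by
  have h := (NormedSpace.expSeries_div_hasSum_exp (-z * s)).mul_left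
    (2 * Complex.exp (-(s : ℂ) ^ 2))
  rw [← Complex.exp_eq_exp_ℂ, mul_assoc, ← Complex.exp_add] at h
  rw [neg_mul, ← sub_eq_add_neg] at h
  refine (funext fun k => ?_ : (fun k => gaussianLaplaceTerm z k s) = _) ▸ h
  unfold gaussianLaplaceTerm
  push_cast
  ring

lemma norm_gaussianLaplaceTerm {s : ℝ} (hs : 0 ≤ s) (z : ℂ) (k : ℕ) :
    ‖gaussianLaplaceTerm z k s‖ = 2 * Real.exp (-s ^ 2) * ((‖z‖ * s) ^ k / k.factorial) := by
  unfold gaussianLaplaceTerm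
  rw [norm_mul, Complex.norm_real, Real.norm_of_nonneg (by positivity)]
  simp only [norm_mul, norm_div, norm_pow, norm_neg, Complex.norm_natCast, Complex.norm_ofNat]
  ring

lemma integrable_exp_neg_sq_add_mul (b : ℝ) :
    Integrable fun s : ℝ => Real.exp (-s ^ 2 + b * s) := by
  have h := (integrable_cexp_quadratic (b := 1) (by simp) b 0).norm
  refine h.congr (Eventually.of_forall fun s => ?_)
  simp only [Complex.norm_exp]
  congr 1
  simp [← Complex.ofReal_pow]

/-- The power series of `kummerF` sums to a Laplace-type integral of the Gaussian. -/
lemma hasSum_kummerF_integral (z : ℂ) :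
    HasSum (fun k : ℕ =>
      ((-1 : ℂ) ^ k * ((Real.Gamma (((k : ℝ) + 1) / 2) / (Nat.factorial k) : ℝ) : ℂ)) * z ^ k)
      (∫ s in Ioi (0 : ℝ), 2 * Complex.exp (-s ^ 2 - z * s)) := by
  have hexp (s : ℝ) : HasSum
      (fun k : ℕ => 2 * Real.exp (-s ^ 2) * ((‖z‖ * s) ^ k / k.factorial))
      (2 * Real.exp (-s ^ 2 + ‖z‖ * s)) := by
    have h := (NormedSpace.expSeries_div_hasSum_exp (‖z‖ * s)).mul_left
      (2 * Real.exp (-s ^ 2))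
    rwa [← Real.exp_eq_exp_ℝ, mul_assoc, ← Real.exp_add] at h
  simp only [← integral_gaussianLaplaceTerm]
  refine hasSum_integral_of_dominated_convergence
    (fun k s => 2 * Real.exp (-s ^ 2) * ((‖z‖ * s) ^ k / k.factorial)) (fun k => ?_)
    (fun k => ?_) (Eventually.of_forall fun s => (hexp s).summable) ?_
    (Eventually.of_forall fun s => hasSum_gaussianLaplaceTerm z s)
  · unfold gaussianLaplaceTerm
    exact Continuous.aestronglyMeasurable (by fun_prop)
  · filter_upwards [ae_restrict_mem measurableSet_Ioi] with s hs
    exact (norm_gaussianLaplaceTerm (le_of_lt hs) z k).le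
  · simp only [fun s => (hexp s).tsum_eq]
    exact ((integrable_exp_neg_sq_add_mul ‖z‖).const_mul 2).integrableOn

lemma norm_kummerF_le_integral (z : ℂ) :
    ‖kummerF z‖ ≤ 2 * ∫ s in Ioi (0 : ℝ), Real.exp (-s ^ 2 + -z.re * s) := by
  rw [kummerF, (hasSum_kummerF_integral z).tsum_eq, ← integral_const_mul]
  refine (norm_integral_le_integral_norm _).trans_eq (integral_congr_ae ?_)
  refine Eventually.of_forall fun s => ?_
  simp only [norm_mul, Complex.norm_ofNat, Complex.norm_exp]
  congr 2
  simp [← Complex.ofReal_pow]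
  ring

lemma norm_kummerF_le_sqrt_pi {z : ℂ} (hz : 0 ≤ z.re) : ‖kummerF z‖ ≤ √Real.pi := by
  have h : ∫ s in Ioi (0 : ℝ), Real.exp (-s ^ 2 + -z.re * s) ≤
      ∫ s in Ioi (0 : ℝ), Real.exp (-1 * s ^ 2) := by
    refine setIntegral_mono_on (integrable_exp_neg_sq_add_mul _).integrableOn
      (integrable_exp_neg_mul_sq one_pos).integrableOn measurableSet_Ioi fun s hs => ?_
    have := mul_nonneg hz (le_of_lt hs)
    exact Real.exp_le_exp.2 (by linarith)
  rw [integral_gaussian_Ioi, div_one] at h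
  linarith [norm_kummerF_le_integral z]

lemma norm_kummerF_le_two_div {z : ℂ} (hz : 0 < z.re) : ‖kummerF z‖ ≤ 2 / z.re := by
  have h : ∫ s in Ioi (0 : ℝ), Real.exp (-s ^ 2 + -z.re * s) ≤
      ∫ s in Ioi (0 : ℝ), Real.exp (-z.re * s) := by
    refine setIntegral_mono_on (integrable_exp_neg_sq_add_mul _).integrableOn
      (integrableOn_exp_mul_Ioi (neg_lt_zero.2 hz) 0) measurableSet_Ioi fun s _ => ?_
    exact Real.exp_le_exp.2 (by linarith [sq_nonneg s])
  rw [integral_exp_mul_Ioi (neg_lt_zero.2 hz)] at h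
  simp only [mul_zero, Real.exp_zero, neg_div_neg_eq] at h
  have h2 : 2 / z.re = 2 * (1 / z.re) := by ring
  linarith [norm_kummerF_le_integral z]


/-- The series defining `F` converges for every `z ∈ ℂ`, and along the ray `arg z = π/4`
one has the bound `|F(t e^{iπ/4})| ≤ C min(1, 1/t)`. -/
theorem kummerF_ray_bound :
    (∀ z : ℂ, Summable fun k : ℕ =>
      ((-1 : ℂ) ^ k * ((Real.Gamma (((k : ℝ) + 1) / 2) / (Nat.factorial k) : ℝ) : ℂ)) * z ^ k) ∧
    ∃ C : ℝ, ∀ t : ℝ, 0 < t →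
      ‖kummerF ((t : ℂ) * Complex.exp (Complex.I * (Real.pi : ℂ) / 4))‖ ≤ C * min 1 t⁻¹ := by
  refine ⟨fun z => (hasSum_kummerF_integral z).summable, max (√Real.pi) (2 * √2), fun t ht => ?_⟩
  have hre : ((t : ℂ) * Complex.exp (Complex.I * (Real.pi : ℂ) / 4)).re = t / √2 := by
    have harg : Complex.I * (Real.pi : ℂ) / 4 = ((Real.pi / 4 : ℝ) : ℂ) * Complex.I := by
      push_cast
      ring
    rw [Complex.re_ofReal_mul, harg, Complex.exp_ofReal_mul_I_re, Real.cos_pi_div_four,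
      Real.sqrt_div_self', mul_one_div]
  have hpos : 0 < t / √2 := by positivity
  rw [mul_min_of_nonneg _ _ (by positivity), mul_one]
  refine le_min ((norm_kummerF_le_sqrt_pi (hre ▸ hpos.le)).trans (le_max_left _ _)) ?_
  refine (norm_kummerF_le_two_div (hre ▸ hpos)).trans ?_
  calc _ = 2 * √2 * t⁻¹ := by
        rw [hre]
        field_simp
    _ ≤ _ := by
        gcongr
        exact le_max_right _ _
end

section
/- Fix δ > 0, and let G(r₁,r₂,θ) = (r₁² + r₂² − 2 r₁ r₂ cos θ)^{1/2}. There exist ε₀ > 0 and c > 0, depending only on δ, such that for all r₁, r₂ > 0 with r₁ + r₂ ∈ [δ/4, 4δ] and all θ with |θ − π| ≤ ε₀, |∂²_θ G(r₁,r₂,θ)| ≥ c r₁ r₂. -/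
open MeasureTheory Set Filter

/-- `G(r₁,r₂,θ) = (r₁² + r₂² − 2r₁r₂ cos θ)^{1/2}`, the Euclidean distance between the points
with polar coordinates `(r₁,0)` and `(r₂,θ)`. -/
noncomputable def Gdist (r r' θ : ℝ) : ℝ :=
  Real.sqrt (r ^ 2 + r' ^ 2 - 2 * r * r' * Real.cos θ)

/-- The first derivative of `Gdist r r'` at a point where the distance does not vanish. -/
theorem hasDerivAt_Gdist {r r' θ : ℝ} (h : 0 < r ^ 2 + r' ^ 2 - 2 * r * r' * Real.cos θ) :
    HasDerivAt (Gdist r r') (r * r' * Real.sin θ / Gdist r r' θ) θ := by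
  have hd : HasDerivAt (fun t => r ^ 2 + r' ^ 2 - 2 * r * r' * Real.cos t)
      (-(2 * r * r' * -Real.sin θ)) θ :=
    ((Real.hasDerivAt_cos θ).const_mul (2 * r * r')).const_sub _
  have hG : Real.sqrt (r ^ 2 + r' ^ 2 - 2 * r * r' * Real.cos θ) ≠ 0 := (Real.sqrt_pos.2 h).ne'
  refine (hd.sqrt h.ne').congr_deriv ?_
  unfold Gdist
  field_simp

/-- The second derivative of `Gdist r r'` at a point where the distance does not vanish. -/
theorem deriv_deriv_Gdist {r r' θ : ℝ} (h : 0 < r ^ 2 + r' ^ 2 - 2 * r * r' * Real.cos θ) :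
    deriv (deriv (Gdist r r')) θ =
      r * r' * Real.cos θ / Gdist r r' θ - (r * r' * Real.sin θ) ^ 2 / Gdist r r' θ ^ 3 := by
  have hcont : Continuous fun t => r ^ 2 + r' ^ 2 - 2 * r * r' * Real.cos t := by fun_prop
  have hev : deriv (Gdist r r') =ᶠ[nhds θ] fun t => r * r' * Real.sin t / Gdist r r' t := by
    filter_upwards [hcont.continuousAt.eventually (lt_mem_nhds h)] with t ht
    exact (hasDerivAt_Gdist ht).deriv
  have hG : Gdist r r' θ ≠ 0 := (Real.sqrt_pos.2 h).ne'
  rw [hev.deriv_eq]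
  refine ((((Real.hasDerivAt_sin θ).const_mul (r * r')).div
    (hasDerivAt_Gdist h) hG).congr_deriv ?_).deriv
  field_simp

/-- Near `θ = π`, the second derivative `∂²_θ G` is bounded below in absolute value by a
multiple of `r₁ r₂` when `r₁ + r₂ ∈ [δ/4, 4δ]`. -/
theorem Gdist_second_derivative_lower_bound (δ : ℝ) (hδ : 0 < δ) :
    ∃ ε₀ > (0 : ℝ), ∃ c > (0 : ℝ), ∀ r₁ r₂ θ : ℝ,
      0 < r₁ → 0 < r₂ → r₁ + r₂ ∈ Set.Icc (δ/4) (4*δ) → |θ - Real.pi| ≤ ε₀ →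
      c * (r₁ * r₂) ≤ |deriv (deriv (Gdist r₁ r₂)) θ| := by
  refine ⟨1, one_pos, 1 / (8 * δ), by positivity, fun r₁ r₂ θ h₁ h₂ hr hθ => ?_⟩
  have hcos : Real.cos θ ≤ -(1 / 2) := by
    have h := Real.one_sub_sq_div_two_le_cos (x := θ - Real.pi)
    rw [Real.cos_sub_pi] at h
    have hsq : (θ - Real.pi) ^ 2 ≤ 1 := (sq_le_one_iff_abs_le_one _).2 hθ
    linarith
  have hp : 0 < r₁ * r₂ := mul_pos h₁ h₂
  have hS : 0 < r₁ ^ 2 + r₂ ^ 2 - 2 * r₁ * r₂ * Real.cos θ := by nlinarith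
  have hG : 0 < Gdist r₁ r₂ θ := Real.sqrt_pos.2 hS
  have hGle : Gdist r₁ r₂ θ ≤ 4 * δ := by
    refine (Real.sqrt_le_left (add_pos h₁ h₂).le).2 ?_ |>.trans hr.2
    nlinarith [Real.neg_one_le_cos θ]
  have hmain : 1 / (8 * δ) * (r₁ * r₂) ≤ -(r₁ * r₂ * Real.cos θ / Gdist r₁ r₂ θ) := by
    calc 1 / (8 * δ) * (r₁ * r₂) = r₁ * r₂ * (1 / 2) / (4 * δ) := by field_simp; norm_num
      _ ≤ r₁ * r₂ * (1 / 2) / Gdist r₁ r₂ θ := by gcongr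
      _ ≤ r₁ * r₂ * -Real.cos θ / Gdist r₁ r₂ θ := by gcongr; linarith
      _ = -(r₁ * r₂ * Real.cos θ / Gdist r₁ r₂ θ) := by ring
  have hsin : 0 ≤ (r₁ * r₂ * Real.sin θ) ^ 2 / Gdist r₁ r₂ θ ^ 3 := by positivity
  rw [deriv_deriv_Gdist hS]
  refine le_trans ?_ (neg_le_abs _)
  linarith
end
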